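/- arXiv:1811.00084 — 8 statements merged into one kernel-verified Lean document; each statement's English description precedes it below -/
import Mathlib

section
/- For every integer i ≥ 0, the polynomial u_i(s) is monic of degree (q^i − 1)/(q − 1) as a polynomial in s over 𝔽_q[T]. Consequently, for every irreducible p(T) ∈ 𝔽_q[T] with p(T) ≠ T, the reduction u_i^{(p(T))}(s) ∈ κ_{p(T)}[s] is monic of degree (q^i − 1)/(q − 1). -/
open Polynomial

/-- The universal supersingular polynomials `u_i(s) ∈ 𝔽_q[T][s]` of Bassa–Beelen, with the
index shifted by one: `uPoly F q 0 = u_{-1} = 0`, `uPoly F q 1 = u_0 = 1`, and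
`u_{i+1}(s) = (s + T^q)^{q^i} u_i(s) - (T^{q^i} - T) s^{q^i} u_{i-1}(s)`.
Here the inner `Polynomial.X : Polynomial F` plays the role of `T` and the outer
variable plays the role of `s`. -/
noncomputable def uPoly (F : Type*) [Field F] (q : ℕ) : ℕ → Polynomial (Polynomial F)
  | 0 => 0
  | 1 => 1
  | i + 2 =>
      (X + C ((X : Polynomial F) ^ q)) ^ (q ^ i) * uPoly F q (i + 1)
        - C ((X : Polynomial F) ^ (q ^ i) - X) * X ^ (q ^ i) * uPoly F q i

theorem uPoly_monic_natDegree_degree_lt (F : Type*) [Field F] {q : ℕ} (hq : 0 < q) (i : ℕ) :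
    (uPoly F q (i + 1)).Monic ∧
      (uPoly F q (i + 1)).natDegree = ∑ j ∈ Finset.range i, q ^ j ∧
      (uPoly F q i).degree < (uPoly F q (i + 1)).degree := by
  induction i with
  | zero => simp [uPoly]
  | succ i ih =>
    obtain ⟨hmonic, hdeg, hlt⟩ := ih
    set A := (X + C ((X : Polynomial F) ^ q)) ^ (q ^ i) * uPoly F q (i + 1) with hA
    set B := C ((X : Polynomial F) ^ (q ^ i) - X) * X ^ (q ^ i) * uPoly F q i with hB
    have hu : uPoly F q (i + 1 + 1) = A - B := by rw [uPoly]
    have hApow : ((X + C ((X : Polynomial F) ^ q)) ^ (q ^ i)).Monic := (monic_X_add_C _).pow _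
    have hAmonic : A.Monic := hApow.mul hmonic
    have hAdeg : A.degree = (q ^ i : ℕ) + (uPoly F q (i + 1)).degree := by
      rw [hA, degree_mul, degree_pow, degree_X_add_C, nsmul_one]
    have hBdeg : B.degree ≤ (q ^ i : ℕ) + (uPoly F q i).degree := by
      rw [hB, degree_mul]
      gcongr
      exact degree_C_mul_X_pow_le _ _
    have hBA : B.degree < A.degree := by
      rw [hAdeg]
      exact hBdeg.trans_lt (WithBot.add_lt_add_left (WithBot.natCast_ne_bot _) hlt)
    have hdegree : (A - B).degree = A.degree := degree_sub_eq_left_of_degree_lt hBA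
    have hnat : (A - B).natDegree = ∑ j ∈ Finset.range (i + 1), q ^ j := by
      rw [natDegree_eq_of_degree_eq hdegree, hA, hApow.natDegree_mul hmonic,
        natDegree_pow, natDegree_X_add_C, mul_one, hdeg, Finset.sum_range_succ, add_comm]
    rw [hu]
    refine ⟨hAmonic.sub_of_left hBA, hnat, ?_⟩
    apply degree_lt_degree
    rw [hnat, hdeg, Finset.sum_range_succ]
    exact Nat.lt_add_of_pos_right (pow_pos hq i)

/-- For every `i ≥ 0`, `u_i` is monic of degree `(q^i - 1)/(q - 1)` in `s`, and consequently
for every irreducible `p(T) ≠ T` its reduction modulo `p(T)` is monic of the same degree. -/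
theorem uPoly_monic_natDegree (q : ℕ) (F : Type*) [Field F] [Fintype F]
    (hF : Fintype.card F = q) (i : ℕ) :
    (uPoly F q (i + 1)).Monic ∧
      (uPoly F q (i + 1)).natDegree = (q ^ i - 1) / (q - 1) ∧
      ∀ p : Polynomial F, Irreducible p → p ≠ X →
        ((uPoly F q (i + 1)).map (Ideal.Quotient.mk (Ideal.span {p}))).Monic ∧
          ((uPoly F q (i + 1)).map (Ideal.Quotient.mk (Ideal.span {p}))).natDegree
            = (q ^ i - 1) / (q - 1) := by
  subst hF
  obtain ⟨hmonic, hdeg, -⟩ := uPoly_monic_natDegree_degree_lt F (Fintype.card_pos (α := F)) i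
  rw [Nat.geomSum_eq (Fintype.one_lt_card (α := F))] at hdeg
  refine ⟨hmonic, hdeg, fun p hp _ => ?_⟩
  have : Nontrivial (Polynomial F ⧸ Ideal.span {p}) := by
    rw [Ideal.Quotient.nontrivial_iff, Ne, Ideal.span_singleton_eq_top]
    exact hp.not_isUnit
  exact ⟨hmonic.map _, (hmonic.natDegree_map _).trans hdeg⟩
end

section
/- For every integer i ≥ 0, the constant term of u_i satisfies u_i(0) = T^{q(q^i − 1)/(q − 1)} in 𝔽_q[T]. -/
open Polynomial

/-- For every `i ≥ 0`, `u_i(0) = T^{q(q^i - 1)/(q - 1)}` in `𝔽_q[T]`. -/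
theorem uPoly_eval_zero (q : ℕ) (F : Type*) [Field F] [Fintype F]
    (hF : Fintype.card F = q) (i : ℕ) :
    Polynomial.eval (0 : Polynomial F) (uPoly F q (i + 1))
      = (X : Polynomial F) ^ (q * ((q ^ i - 1) / (q - 1))) := by
  have hq : 2 ≤ q := hF ▸ Fintype.one_lt_card
  rw [← Nat.geomSum_eq hq]
  induction i with
  | zero => simp [uPoly]
  | succ i ih =>
    have hpow : q ^ i ≠ 0 := pow_ne_zero _ (by lia)
    rw [uPoly, Finset.sum_range_succ]
    simp only [eval_sub, eval_mul, eval_pow, eval_add, eval_X, eval_C, ih, zero_add,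
      zero_pow hpow, mul_zero, zero_mul, sub_zero]
    ring
end

section
/- For every integer i ≥ 0, the following identity holds in the field of rational functions 𝔽_q(T)(s): u_i(−T^q · s(s+1)^{q−1}) − (T(s+1))^{q^i − 1} · u_i(−T · s^q/(s+1)^{q−1}) = −(T^{q^i} − T) · (T(s+1))^{q^i − 1} · u_{i−1}(−T · s^q/(s+1)^{q−1}), where u_i is evaluated (via the canonical embedding of 𝔽_q[T] into 𝔽_q(T)(s)) at the indicated rational functions. -/
open Polynomial

/-- Evaluating `uPoly` at a point gives a sequence satisfying the same three-term recursion. -/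
theorem eval₂_uPoly_add_two {F K : Type*} [Field F] [CommRing K] (φ : Polynomial F →+* K)
    (q : ℕ) (x : K) (i : ℕ) :
    Polynomial.eval₂ φ x (uPoly F q (i + 2)) =
      (x + φ X ^ q) ^ q ^ i * Polynomial.eval₂ φ x (uPoly F q (i + 1))
        - (φ X ^ q ^ i - φ X) * x ^ q ^ i * Polynomial.eval₂ φ x (uPoly F q i) := by
  simp [uPoly, eval₂_sub, eval₂_mul, eval₂_pow, eval₂_add]

/-- The comparison of the values of `uPoly` at two points `a`, `b` related through an auxiliary
element `y`, over any commutative ring of characteristic `p` with `q = p ^ n`. -/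
theorem eval₂_uPoly_eq_of_relations {F K : Type*} [Field F] [CommRing K] (p n q : ℕ)
    [ExpChar K p] (hq : q = p ^ n) (hq0 : 0 < q) (φ : Polynomial F →+* K) (a b y : K)
    (hab : a + φ X ^ q = y ^ (q - 1) * (b + φ X))
    (hb : a ^ q = y ^ (q ^ 2 - 1) * b) (i : ℕ) :
    Polynomial.eval₂ φ a (uPoly F q (i + 1)) = y ^ (q ^ i - 1) *
      (Polynomial.eval₂ φ b (uPoly F q (i + 1))
        - (φ X ^ q ^ i - φ X) * Polynomial.eval₂ φ b (uPoly F q i)) := by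
  induction i using Nat.twoStepInduction with
  | zero => simp [uPoly]
  | one =>
    simp only [eval₂_uPoly_add_two φ q _ 0]
    simp only [uPoly, eval₂_one, eval₂_zero, pow_zero, pow_one]
    linear_combination hab
  | more i ih₀ ih₁ =>
    have hpos : 0 < q ^ i := pow_pos hq0 i
    have hfrob : ∀ x z : K, (x + z) ^ q ^ (i + 1) = x ^ q ^ (i + 1) + z ^ q ^ (i + 1) := by
      intro x z
      rw [hq, ← pow_mul]
      exact add_pow_expChar_pow x z p (n * (i + 1))
    have hshift : y ^ (q ^ (i + 2) - 1) = (y ^ (q - 1)) ^ q ^ (i + 1) * y ^ (q ^ (i + 1) - 1) := by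
      rw [← pow_mul, ← pow_add]
      congr 1
      have : 0 < q ^ (i + 1) := pow_pos hq0 _
      obtain ⟨r, rfl⟩ : ∃ r, q = r + 1 := ⟨q - 1, by omega⟩
      have h : (r + 1) ^ (i + 2) = r * (r + 1) ^ (i + 1) + (r + 1) ^ (i + 1) := by ring
      rw [h, Nat.add_sub_cancel]
      omega
    have hmul : a ^ q ^ (i + 1) * y ^ (q ^ i - 1) = y ^ (q ^ (i + 2) - 1) * b ^ q ^ i := by
      have h : a ^ q ^ (i + 1) = y ^ ((q ^ 2 - 1) * q ^ i) * b ^ q ^ i := by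
        rw [pow_succ', pow_mul, hb, mul_pow, ← pow_mul]
      rw [h, mul_right_comm, ← pow_add]
      congr 2
      have h2 : 0 < q ^ 2 := pow_pos hq0 2
      obtain ⟨r, hr⟩ : ∃ r, q ^ 2 = r + 1 := ⟨q ^ 2 - 1, by omega⟩
      have h : q ^ (i + 2) = r * q ^ i + q ^ i := by rw [pow_add, hr]; ring
      rw [h, hr, Nat.add_sub_cancel]
      omega
    have habQ : (a + φ X ^ q) ^ q ^ (i + 1)
        = (y ^ (q - 1)) ^ q ^ (i + 1) * (b ^ q ^ (i + 1) + φ X ^ q ^ (i + 1)) := by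
      rw [hab, mul_pow, hfrob b]
    have hbQ : (b + φ X ^ q) ^ q ^ (i + 1) = b ^ q ^ (i + 1) + φ X ^ q ^ (i + 2) := by
      rw [hfrob b, ← pow_mul, ← pow_succ']
    have hbQ' : (b + φ X ^ q) ^ q ^ i = b ^ q ^ i + φ X ^ q ^ (i + 1) := by
      rw [hq, ← pow_mul p n i, add_pow_expChar_pow b _ p (n * i), ← pow_mul, ← pow_add,
        ← pow_mul, mul_add_one, add_comm n]
    have hV := eval₂_uPoly_add_two φ q b i
    rw [hbQ'] at hV
    rw [eval₂_uPoly_add_two φ q a (i + 1), eval₂_uPoly_add_two φ q b (i + 1), ih₁, ih₀,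
      habQ, hbQ]
    generalize eval₂ φ b (uPoly F q (i + 2)) = V₂ at *
    generalize eval₂ φ b (uPoly F q (i + 1)) = V₁ at *
    generalize eval₂ φ b (uPoly F q i) = V₀ at *
    generalize φ X = t at *
    linear_combination (-(b ^ q ^ (i + 1) + t ^ q ^ (i + 1)) *
        (V₂ - (t ^ q ^ (i + 1) - t) * V₁)) * hshift
      - (t ^ q ^ (i + 1) - t) * (V₁ - (t ^ q ^ i - t) * V₀) * hmul
      + (t ^ q ^ (i + 1) - t) * y ^ (q ^ (i + 2) - 1) * hV

/-- The key identity of Proposition 2 of Bassa–Beelen, in the rational function field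
`𝔽_q(T)(s)`, realized as `RatFunc (RatFunc F)`, where `t` is the image of `T` and `s` the
outer variable:
`u_i(-T^q s(s+1)^{q-1}) - (T(s+1))^{q^i-1} u_i(-T s^q/(s+1)^{q-1})
  = -(T^{q^i} - T)(T(s+1))^{q^i-1} u_{i-1}(-T s^q/(s+1)^{q-1})`. -/
theorem uPoly_key_identity (q : ℕ) (F : Type*) [Field F] [Fintype F]
    (hF : Fintype.card F = q) (i : ℕ) :
    let t : RatFunc (RatFunc F) := RatFunc.C RatFunc.X
    let s : RatFunc (RatFunc F) := RatFunc.X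
    let φ : Polynomial F →+* RatFunc (RatFunc F) :=
      (RatFunc.C : RatFunc F →+* RatFunc (RatFunc F)).comp
        (algebraMap (Polynomial F) (RatFunc F))
    Polynomial.eval₂ φ (-t ^ q * (s * (s + 1) ^ (q - 1))) (uPoly F q (i + 1))
        - (t * (s + 1)) ^ (q ^ i - 1) *
            Polynomial.eval₂ φ (-t * (s ^ q / (s + 1) ^ (q - 1))) (uPoly F q (i + 1))
      = -(t ^ (q ^ i) - t) * (t * (s + 1)) ^ (q ^ i - 1) *
          Polynomial.eval₂ φ (-t * (s ^ q / (s + 1) ^ (q - 1))) (uPoly F q i) := by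
  intro t s φ
  obtain ⟨n, hp, hn⟩ := FiniteField.card F (ringChar F)
  have : Fact (ringChar F).Prime := ⟨hp⟩
  have : CharP (RatFunc (RatFunc F)) (ringChar F) := charP_of_injective_ringHom
    ((RatFunc.C : RatFunc F →+* RatFunc (RatFunc F)).comp
      (RatFunc.C : F →+* RatFunc F)).injective (ringChar F)
  have hq : q = ringChar F ^ (n : ℕ) := hF.symm.trans hn
  have hq0 : 0 < q := hF ▸ Fintype.card_pos
  have hs : s + 1 ≠ 0 := by
    have h := (map_ne_zero_iff (algebraMap (Polynomial (RatFunc F)) (RatFunc (RatFunc F)))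
      (RatFunc.algebraMap_injective _)).2 (Polynomial.X_add_C_ne_zero (1 : RatFunc F))
    simpa [s] using h
  have hφ : φ X = t := by simp [φ, t]
  have hfrob : (s + 1) ^ q = s ^ q + 1 := by
    rw [hq, add_pow_expChar_pow, one_pow]
  have hneg : (-1 : RatFunc (RatFunc F)) ^ q = -1 := by
    rw [hq, neg_one_pow_expChar_pow]
  have key := eval₂_uPoly_eq_of_relations (ringChar F) n q hq hq0 φ
    (-t ^ q * (s * (s + 1) ^ (q - 1))) (-t * (s ^ q / (s + 1) ^ (q - 1))) (t * (s + 1)) ?_ ?_ i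
  · rw [hφ] at key
    rw [key]
    ring
  · rw [hφ]
    obtain ⟨r, rfl⟩ : ∃ r, q = r + 1 := ⟨q - 1, by omega⟩
    simp only [Nat.add_sub_cancel]
    have hdiv : (s + 1) ^ r * (s ^ (r + 1) / (s + 1) ^ r) = s ^ (r + 1) :=
      mul_div_cancel₀ _ (pow_ne_zero r hs)
    rw [mul_pow t (s + 1) r]
    linear_combination t ^ (r + 1) * hdiv - t ^ (r + 1) * hfrob
  · obtain ⟨r, hr⟩ : ∃ r, q = r + 1 := ⟨q - 1, by omega⟩
    have h : q ^ 2 - 1 = r * q + r := by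
      rw [hr, show (r + 1) ^ 2 = r * (r + 1) + r + 1 by ring, Nat.add_sub_cancel]
    have hr' : q - 1 = r := by omega
    have hdiv : (s + 1) ^ r * (s ^ q / (s + 1) ^ r) = s ^ q :=
      mul_div_cancel₀ _ (pow_ne_zero r hs)
    have ht : t ^ (r * q) * t ^ r * t = (t ^ q) ^ q := by
      rw [← pow_mul, ← pow_add, ← pow_succ]
      congr 1
      rw [hr]
      ring
    have hfac : (-t ^ q * (s * (s + 1) ^ r)) ^ q
        = (-1) ^ q * (t ^ q) ^ q * s ^ q * (s + 1) ^ (r * q) := by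
      rw [pow_mul (s + 1) r q, neg_eq_neg_one_mul]
      simp only [mul_pow]
      ring
    rw [h, hr', hfac, hneg, pow_add, mul_pow t (s + 1) r, mul_pow t (s + 1) (r * q)]
    linear_combination (s + 1) ^ (r * q) * s ^ q * ht
      + t ^ (r * q) * t ^ r * t * (s + 1) ^ (r * q) * hdiv
end

section
/- In the rational function field 𝔽_q(T)(Θ), set Δ_0 = Θ^{q−1}(Θ + T) and Δ_1 = (Θ + T)^q / Θ^{q−1}. Then (Δ_0 + T^q)^{q+1} / Δ_0^q = (Δ_1 + T)^{q+1} / Δ_1, and moreover (Δ_0·Δ_1 − T^{q+1}) / (Δ_0 + T^q) = Θ. -/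
theorem RatFunc.X_pow_mul_X_add_C_add_C_ne_zero {K : Type*} [Field K] {n : ℕ} (hn : n ≠ 0)
    (a : K) {b : K} (hb : b ≠ 0) :
    (RatFunc.X ^ n * (RatFunc.X + RatFunc.C a) + RatFunc.C b : RatFunc K) ≠ 0 := by
  have hp : (Polynomial.X ^ n * (Polynomial.X + Polynomial.C a) + Polynomial.C b :
      Polynomial K) ≠ 0 := by
    intro h
    have := congrArg (Polynomial.eval 0) h
    simp [hn, hb] at this
  simpa using RatFunc.algebraMap_ne_zero hp

section

variable {K : Type*} [Field K] {n : ℕ} {x t : K}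

theorem pow_mul_add_add_pow_eq (hadd : (x + t) ^ (n + 1) = x ^ (n + 1) + t ^ (n + 1)) :
    x ^ n * (x + t) + t ^ (n + 1) = (x + t) ^ (n + 1) + x ^ n * t := by
  rw [hadd]
  ring

theorem pow_div_pow_eq_pow_div_of_add_pow (hx : x ≠ 0)
    (hadd : (x + t) ^ (n + 1) = x ^ (n + 1) + t ^ (n + 1)) :
    (x ^ n * (x + t) + t ^ (n + 1)) ^ (n + 2) / (x ^ n * (x + t)) ^ (n + 1) =
      ((x + t) ^ (n + 1) / x ^ n + t) ^ (n + 2) / ((x + t) ^ (n + 1) / x ^ n) := by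
  have hxn : x ^ n ≠ 0 := pow_ne_zero n hx
  have h : (x + t) ^ (n + 1) / x ^ n + t = (x ^ n * (x + t) + t ^ (n + 1)) / x ^ n := by
    rw [pow_mul_add_add_pow_eq hadd]
    field_simp
  rw [h, div_pow, mul_pow, div_div_div_eq, pow_succ (x ^ n) (n + 1),
    mul_right_comm, mul_div_mul_right _ _ hxn]

theorem mul_sub_pow_div_eq_of_add_pow (hx : x ≠ 0)
    (hadd : (x + t) ^ (n + 1) = x ^ (n + 1) + t ^ (n + 1))
    (hN : x ^ n * (x + t) + t ^ (n + 1) ≠ 0) :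
    (x ^ n * (x + t) * ((x + t) ^ (n + 1) / x ^ n) - t ^ (n + 2)) /
      (x ^ n * (x + t) + t ^ (n + 1)) = x := by
  have hxn : x ^ n ≠ 0 := pow_ne_zero n hx
  rw [div_eq_iff hN, mul_assoc, mul_left_comm, mul_div_cancel₀ _ hxn, hadd]
  ring

end


/-- In the rational function field `𝔽_q(T)(Θ)`, realized as `RatFunc (RatFunc F)` with `t`
the image of `T` and `θ` the outer variable `Θ`, setting
`Δ₀ = Θ^{q-1}(Θ + T)` and `Δ₁ = (Θ + T)^q / Θ^{q-1}`, one has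
`(Δ₀ + T^q)^{q+1} / Δ₀^q = (Δ₁ + T)^{q+1} / Δ₁` and
`(Δ₀ Δ₁ - T^{q+1}) / (Δ₀ + T^q) = Θ`. -/
theorem theta_uniformizer (q : ℕ) (F : Type*) [Field F] [Fintype F]
    (hF : Fintype.card F = q) :
    let t : RatFunc (RatFunc F) := RatFunc.C RatFunc.X
    let θ : RatFunc (RatFunc F) := RatFunc.X
    let Δ₀ : RatFunc (RatFunc F) := θ ^ (q - 1) * (θ + t)
    let Δ₁ : RatFunc (RatFunc F) := (θ + t) ^ q / θ ^ (q - 1)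
    (Δ₀ + t ^ q) ^ (q + 1) / Δ₀ ^ q = (Δ₁ + t) ^ (q + 1) / Δ₁ ∧
      (Δ₀ * Δ₁ - t ^ (q + 1)) / (Δ₀ + t ^ q) = θ := by
  intro t θ Δ₀ Δ₁
  obtain ⟨p, hp⟩ := CharP.exists F
  have := Fact.mk (CharP.char_is_prime F p)
  have : CharP (RatFunc F) p :=
    charP_of_injective_algebraMap (algebraMap F (RatFunc F)).injective p
  have : CharP (RatFunc (RatFunc F)) p :=
    charP_of_injective_algebraMap (algebraMap (RatFunc F) (RatFunc (RatFunc F))).injective p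
  obtain ⟨k, -, hk⟩ := FiniteField.card F p
  have hadd : (θ + t) ^ q = θ ^ q + t ^ q := by
    rw [← hF, hk]
    exact add_pow_char_pow θ t p k
  have hq : 1 < q := hF ▸ Fintype.one_lt_card
  obtain ⟨n, rfl⟩ : ∃ n, q = n + 1 := ⟨q - 1, by omega⟩
  have hθ : θ ≠ 0 := RatFunc.X_ne_zero
  have hN : θ ^ n * (θ + t) + t ^ (n + 1) ≠ 0 := by
    have := RatFunc.X_pow_mul_X_add_C_add_C_ne_zero (n := n) (by omega) (RatFunc.X : RatFunc F)
      (pow_ne_zero (n + 1) RatFunc.X_ne_zero)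
    rwa [map_pow] at this
  exact ⟨pow_div_pow_eq_pow_div_of_add_pow hθ hadd, mul_sub_pow_div_eq_of_add_pow hθ hadd hN⟩
end

section
/- Define polynomials U_i(s) with coefficients in 𝔽_q(T) by U_{−1}(s) = 0, U_0(s) = 1, and U_{i+1}(s) = ((s^q − s)^{q−1} + 1/T^{q−1})^{q^i} · U_i(s) − ((T^{q^i} − T)/T^{q^{i+1}}) · (s^q − s)^{(q−1)q^{i−1}} · U_{i−1}(s) for i ≥ 1, with U_1(s) = (s^q − s)^{q−1} + 1/T^{q−1}. Then for every integer i ≥ 0 the following identity holds in the rational function field 𝔽_q(T)(s): U_i(s) = ((s^q − s)^{q−1} / T^q)^{(q^i − 1)/(q − 1)} · u_i( T / (s^q − s)^{q−1} ), where u_i is evaluated at the indicated rational function. -/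
open Polynomial

/-- The polynomials `U_i(s)` with coefficients in `𝔽_q(T)` (realized as `RatFunc F` with
`T = RatFunc.X`), with the index shifted by one: `UPoly F q 0 = U_{-1} = 0`,
`UPoly F q 1 = U_0 = 1`, `UPoly F q 2 = U_1 = (s^q - s)^{q-1} + 1/T^{q-1}`, and for `i ≥ 1`
`U_{i+1}(s) = ((s^q - s)^{q-1} + 1/T^{q-1})^{q^i} U_i(s)
  - ((T^{q^i} - T)/T^{q^{i+1}}) (s^q - s)^{(q-1)q^{i-1}} U_{i-1}(s)`. -/
noncomputable def UPoly (F : Type*) [Field F] (q : ℕ) : ℕ → Polynomial (RatFunc F)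
  | 0 => 0
  | 1 => 1
  | 2 => (X ^ q - X) ^ (q - 1) + C (1 / (RatFunc.X : RatFunc F) ^ (q - 1))
  | i + 3 =>
      ((X ^ q - X) ^ (q - 1) + C (1 / (RatFunc.X : RatFunc F) ^ (q - 1))) ^ (q ^ (i + 1)) *
          UPoly F q (i + 2)
        - C (((RatFunc.X : RatFunc F) ^ (q ^ (i + 1)) - RatFunc.X)
              / (RatFunc.X : RatFunc F) ^ (q ^ (i + 2))) *
            (X ^ q - X) ^ ((q - 1) * q ^ i) * UPoly F q (i + 1)

/-- The fraction `(q ^ i - 1) / (q - 1)` is a geometric sum, so it grows by `q ^ i`. -/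
theorem pow_succ_sub_one_div {q : ℕ} (hq : 2 ≤ q) (i : ℕ) :
    (q ^ (i + 1) - 1) / (q - 1) = (q ^ i - 1) / (q - 1) + q ^ i := by
  rw [← Nat.geomSum_eq hq, ← Nat.geomSum_eq hq, Finset.sum_range_succ]

theorem RatFunc.X_pow_sub_X_ne_zero (K : Type*) [Field K] {q : ℕ} (hq : 2 ≤ q) :
    (RatFunc.X : RatFunc K) ^ q - RatFunc.X ≠ 0 := by
  rw [← RatFunc.algebraMap_X, ← map_pow, ← map_sub]
  exact RatFunc.algebraMap_ne_zero (FiniteField.X_pow_card_sub_X_ne_zero K hq)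

theorem div_pow_mul_add_pow {K : Type*} [Field K] {t w : K} (ht : t ≠ 0) (hw : w ≠ 0)
    {q : ℕ} (hq : 2 ≤ q) (n : ℕ) :
    (w / t ^ q) ^ n * (t / w + t ^ q) ^ n = (w + 1 / t ^ (q - 1)) ^ n := by
  obtain ⟨m, rfl⟩ : ∃ m, q = m + 1 := ⟨q - 1, by omega⟩
  rw [← mul_pow, Nat.add_sub_cancel]
  congr 1
  field_simp
  ring

theorem div_pow_mul_div_pow {K : Type*} [Field K] {t w : K} (ht : t ≠ 0) (hw : w ≠ 0)
    (q i : ℕ) :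
    (w / t ^ q) ^ (q ^ i + q ^ (i + 1)) * (t / w) ^ (q ^ (i + 1)) =
      w ^ (q ^ i) / t ^ (q ^ (i + 2)) := by
  have h : w / t ^ q * (t / w) = t / t ^ q := by field_simp
  rw [pow_add, mul_assoc, ← mul_pow, h, div_pow, div_pow, ← pow_mul, ← pow_mul,
    ← pow_succ', ← pow_succ']
  field_simp

/-- For every `i ≥ 0`, in the rational function field `𝔽_q(T)(s)`, realized as
`RatFunc (RatFunc F)` with `t` the image of `T` and `s` the outer variable:
`U_i(s) = ((s^q - s)^{q-1} / T^q)^{(q^i - 1)/(q - 1)} · u_i(T / (s^q - s)^{q-1})`. -/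
theorem UPoly_eq_uPoly (q : ℕ) (F : Type*) [Field F] [Fintype F]
    (hF : Fintype.card F = q) (i : ℕ) :
    let t : RatFunc (RatFunc F) := RatFunc.C RatFunc.X
    let s : RatFunc (RatFunc F) := RatFunc.X
    let φ : Polynomial F →+* RatFunc (RatFunc F) :=
      (RatFunc.C : RatFunc F →+* RatFunc (RatFunc F)).comp
        (algebraMap (Polynomial F) (RatFunc F))
    Polynomial.eval₂ (RatFunc.C : RatFunc F →+* RatFunc (RatFunc F)) s (UPoly F q (i + 1))
      = ((s ^ q - s) ^ (q - 1) / t ^ q) ^ ((q ^ i - 1) / (q - 1)) *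
          Polynomial.eval₂ φ (t / (s ^ q - s) ^ (q - 1)) (uPoly F q (i + 1)) := by
  intro t s φ
  have hq : 2 ≤ q := hF ▸ Fintype.one_lt_card
  have ht : t ≠ 0 := (_root_.map_ne_zero _).2 RatFunc.X_ne_zero
  have hw : (s ^ q - s) ^ (q - 1) ≠ 0 :=
    pow_ne_zero _ (RatFunc.X_pow_sub_X_ne_zero (RatFunc F) hq)
  have hφ : φ X = t := by simp [φ, t]
  induction i using Nat.twoStepInduction with
  | zero => simp [UPoly, uPoly]
  | one =>
    have h := div_pow_mul_add_pow ht hw hq 1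
    have hd : (q ^ 1 - 1) / (q - 1) = 1 := by
      rw [pow_one]
      exact Nat.div_self (by omega)
    simp only [pow_one] at h
    rw [hd]
    simp [UPoly, uPoly, eval₂_add, eval₂_sub, eval₂_pow, hφ, h]
    simp [t]
  | more i ih₀ ih₁ =>
    rw [UPoly, uPoly]
    simp only [eval₂_add, eval₂_sub, eval₂_mul, eval₂_pow, eval₂_X, eval₂_C, ih₀, ih₁, map_sub,
      map_pow, map_div₀, map_one, hφ]
    change (_ + 1 / t ^ (q - 1)) ^ _ * _ - (t ^ _ - t) / t ^ _ * _ * _ = _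
    rw [← div_pow_mul_add_pow ht hw hq, pow_mul]
    have h := div_pow_mul_div_pow ht hw q i
    rw [pow_succ_sub_one_div hq (i + 1), pow_succ_sub_one_div hq i]
    generalize (s ^ q - s) ^ (q - 1) = w at *
    rw [mul_sub]
    congr 1
    · ring
    · rw [div_mul_eq_mul_div, mul_div_assoc, ← h]
      ring
end

section
/- Let p(T) ∈ 𝔽_q[T] be irreducible with p(T) ≠ T and deg p(T) = d, let α be the image of T in κ_{p(T)}, and let L be an algebraic closure of κ_{p(T)}. Let a ∈ L with a ≠ −1, and set ξ = −α^q · a(a+1)^{q−1} and η = −α · a^q/(a+1)^{q−1}. Then u_d^{(p(T))}(ξ) = 0 if and only if u_d^{(p(T))}(η) = 0. -/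
open Polynomial

section Recursion

variable {F R : Type*} [Field F] [CommRing R] (q : ℕ) (χ : Polynomial F →+* R)

lemma eval₂_uPoly_add_two_s10 (s : R) (i : ℕ) :
    eval₂ χ s (uPoly F q (i + 2)) =
      (s + χ X ^ q) ^ q ^ i * eval₂ χ s (uPoly F q (i + 1))
        - (χ X ^ q ^ i - χ X) * s ^ q ^ i * eval₂ χ s (uPoly F q i) := by
  simp [uPoly, eval₂_sub, eval₂_mul, eval₂_pow, eval₂_add]

/-- Conjugating by `b` turns the Drinfeld module `(s τ + T)(τ + 1)`, which is isogenous to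
`(τ + 1)(s τ + T)`, into `(τ + 1)(t τ + T)`. The isogeny relates the values of `u_i`
at `s` and at `t`. -/
lemma mul_eval₂_uPoly_of_isogeny
    (hadd : ∀ (i : ℕ) (x y : R), (x + y) ^ q ^ i = x ^ q ^ i + y ^ q ^ i) {s t b : R}
    (hg : b * (t + χ X ^ q) = (s + χ X) * b ^ q) (hΔ : t ^ q * b = s * b ^ q ^ 2) (i : ℕ) :
    b * eval₂ χ t (uPoly F q (i + 1)) =
      b ^ q ^ i * (eval₂ χ s (uPoly F q (i + 1))
        - (χ X ^ q ^ i - χ X) * eval₂ χ s (uPoly F q i)) := by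
  induction i using Nat.twoStepInduction with
  | zero => simp [uPoly]
  | one =>
    simp only [eval₂_uPoly_add_two_s10]
    simp [uPoly]
    linear_combination hg
  | more k ih₁ ih₂ =>
    have hs := eval₂_uPoly_add_two_s10 q χ s (k + 1)
    have hs' := eval₂_uPoly_add_two_s10 q χ s k
    have ht := eval₂_uPoly_add_two_s10 q χ t (k + 1)
    have hgk := congrArg (· ^ q ^ (k + 1)) hg
    have hΔk := congrArg (· ^ q ^ k) hΔ
    simp only [mul_pow, hadd, ← pow_mul, ← pow_succ', ← pow_add] at hgk hΔk hs hs' ht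
    rw [show 2 + k = k + 2 by ring] at hΔk
    linear_combination b * ht + (t ^ q ^ (k + 1) + χ X ^ q ^ (k + 1 + 1)) * ih₂
      - (χ X ^ q ^ (k + 1) - χ X) * t ^ q ^ (k + 1) * ih₁
      + (eval₂ χ s (uPoly F q (k + 2)) - (χ X ^ q ^ (k + 1) - χ X) * eval₂ χ s (uPoly F q (k + 1)))
        * hgk
      - (χ X ^ q ^ (k + 1) - χ X) *
        (eval₂ χ s (uPoly F q (k + 1)) - (χ X ^ q ^ k - χ X) * eval₂ χ s (uPoly F q k)) * hΔk
      + (χ X ^ q ^ (k + 1) - χ X) * b ^ q ^ (k + 2) * hs' - b ^ q ^ (k + 2) * hs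

end Recursion

/-- For `p(T)` irreducible of degree `d` with `p(T) ≠ T`, `α` the image of `T` in the
residue field `κ_{p(T)} = 𝔽_q[T]/(p(T))` (realized as `AdjoinRoot p`), `L` an algebraic
closure of `κ_{p(T)}`, and `a ∈ L` with `a ≠ -1`: setting `ξ = -α^q a(a+1)^{q-1}` and
`η = -α a^q/(a+1)^{q-1}`, one has `u_d^{(p(T))}(ξ) = 0 ↔ u_d^{(p(T))}(η) = 0`. -/
theorem uPoly_root_iff (q : ℕ) (F : Type*) [Field F] [Fintype F]
    (hF : Fintype.card F = q) (p : Polynomial F) [hp : Fact (Irreducible p)] (hpX : p ≠ X)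
    (L : Type*) [Field L] [Algebra (AdjoinRoot p) L] [IsAlgClosure (AdjoinRoot p) L]
    (a : L) (ha : a ≠ -1) :
    let α : L := algebraMap (AdjoinRoot p) L (AdjoinRoot.root p)
    let χ : Polynomial F →+* L := (algebraMap (AdjoinRoot p) L).comp (AdjoinRoot.mk p)
    (Polynomial.eval₂ χ (-α ^ q * (a * (a + 1) ^ (q - 1))) (uPoly F q (p.natDegree + 1)) = 0
      ↔ Polynomial.eval₂ χ (-α * (a ^ q / (a + 1) ^ (q - 1)))
          (uPoly F q (p.natDegree + 1)) = 0) := by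
  intro α χ
  have hq : 1 < q := hF ▸ Fintype.one_lt_card
  obtain ⟨r, hrF⟩ := CharP.exists F
  obtain ⟨n, hr, hcard⟩ := FiniteField.card F r
  have := Fact.mk hr
  have : CharP L r := charP_of_injective_ringHom (χ.comp C).injective r
  have hadd (i : ℕ) (x y : L) : (x + y) ^ q ^ i = x ^ q ^ i + y ^ q ^ i := by
    rw [← hF, hcard, ← pow_mul, add_pow_char_pow]
  have hχ : χ X = α := by simp [χ, α]
  have hα : α ^ q ^ p.natDegree = α := by
    have hp0 : p ≠ 0 := hp.out.ne_zero
    have := (AdjoinRoot.powerBasis hp0).finite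
    have := Module.finite_of_finite F (M := AdjoinRoot p)
    have := Fintype.ofFinite (AdjoinRoot p)
    have h := FiniteField.pow_card (AdjoinRoot.root p)
    rw [Module.card_eq_pow_finrank (K := F), (AdjoinRoot.powerBasis hp0).finrank,
      AdjoinRoot.powerBasis_dim, hF] at h
    rw [← map_pow, h]
  by_cases hα0 : α = 0
  · simp [hα0, show q ≠ 0 by omega]
  have hc : a + 1 ≠ 0 := fun h => ha (eq_neg_of_add_eq_zero_left h)
  have hb : α * (a + 1) ≠ 0 := mul_ne_zero hα0 hc
  have haq : (a + 1) ^ q = a ^ q + 1 := by simpa using hadd 1 a 1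
  have hneg : (-1 : L) ^ q = -1 := by
    have := hadd 1 1 (-1)
    simp [show q ≠ 0 by omega] at this
    linear_combination -this
  obtain ⟨m, rfl⟩ : ∃ m, q = m + 1 := ⟨q - 1, by omega⟩
  obtain ⟨c, hca⟩ : ∃ c, c = a + 1 := ⟨_, rfl⟩
  rw [← hca] at hc hb haq ⊢
  have key := mul_eval₂_uPoly_of_isogeny (m + 1) χ hadd (b := α * c)
    (t := -α ^ (m + 1) * (a * c ^ m)) (s := -α * (a ^ (m + 1) / c ^ m))
    (by
      rw [hχ, mul_pow]
      field_simp
      linear_combination c * c ^ m * (c ^ m * hca - haq))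
    (by
      rw [neg_mul, neg_pow, hneg]
      field_simp
      ring) p.natDegree
  rw [hχ, hα, sub_self, zero_mul, sub_zero] at key
  rw [Nat.add_sub_cancel, ← mul_eq_zero_iff_left hb, key,
    mul_eq_zero_iff_left (pow_ne_zero _ hb)]
end

section
/- Let p be an odd prime and m = (p − 1)/2. In the polynomial ring 𝔽_p[s][X], the coefficient of X^{p−1} in the polynomial (X(X − 1)(X − s))^m equals (−1)^m · H_p(s), where H_p(s) = Σ_{i=0}^{m} binom(m, i)^2 · s^i is the Deuring polynomial. -/
open Polynomial

theorem coeff_legendre_cubic_pow {R : Type*} [CommRing R] (r : R) (m : ℕ) :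
    ((X * (X - 1) * (X - C r)) ^ m : R[X]).coeff (m + m) =
      (-1) ^ m * ∑ i ∈ Finset.range (m + 1), (m.choose i : R) ^ 2 * r ^ i := by
  have h : (X * (X - 1) * (X - C r) : R[X]) = X * ((X + C (-1)) * (X + C (-r))) := by
    simp only [C_neg, C_1]
    ring
  rw [h, mul_pow, coeff_X_pow_mul, mul_pow, coeff_mul,
    Finset.Nat.sum_antidiagonal_eq_sum_range_succ_mk, Finset.mul_sum]
  refine Finset.sum_congr rfl fun i hi => ?_
  have him : i ≤ m := Nat.lt_succ_iff.mp (Finset.mem_range.mp hi)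
  rw [coeff_X_add_C_pow, coeff_X_add_C_pow, Nat.sub_sub_self him, Nat.choose_symm him,
    neg_pow r i, ← pow_sub_mul_pow (-1 : R) him]
  ring

/-- Let `p` be an odd prime and `m = (p-1)/2`. In `𝔽_p[s][X]` (realized as
`Polynomial (Polynomial (ZMod p))`, with `s` the variable of the coefficient ring), the
coefficient of `X^{p-1}` in `(X(X-1)(X-s))^m` equals `(-1)^m H_p(s)`, where
`H_p(s) = ∑_{i=0}^{m} binom(m,i)^2 s^i` is the Deuring polynomial. -/
theorem deuring_coeff (p : ℕ) (hp : p.Prime) (hodd : Odd p) :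
    let m := (p - 1) / 2
    (((X * (X - 1) * (X - C (Polynomial.X : Polynomial (ZMod p)))) ^ m :
          Polynomial (Polynomial (ZMod p))).coeff (p - 1))
      = (-1) ^ m *
          ∑ i ∈ Finset.range (m + 1),
            ((Nat.choose m i : Polynomial (ZMod p)) ^ 2 * Polynomial.X ^ i) := by
  intro m
  have hm : p - 1 = m + m := by
    obtain ⟨k, rfl⟩ := hodd
    simp only [m]
    omega
  rw [hm]
  exact coeff_legendre_cubic_pow X m
end

section
/- Let L be an algebraically closed field containing 𝔽_q and let t ∈ L with t ≠ 0. Define j(λ) = t^q · (1 + (λ^q − λ)^{q−1})^{q+1} / (λ^q − λ)^{q^2 − q} for λ ∈ L ∖ 𝔽_q. Then the map λ ↦ j(λ) from L ∖ 𝔽_q to L is surjective, and for every c ∈ L with c ≠ 0 the fiber {λ ∈ L ∖ 𝔽_q : j(λ) = c} has exactly q^3 − q elements. -/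
open Polynomial

/-- In an extension of a finite field `F` with `q` elements, the fixed points of `x ↦ x ^ q` are
the elements of `F`. -/
theorem FiniteField.mem_range_algebraMap_iff_pow_card_sub_eq_zero {F L : Type*} [Field F]
    [Fintype F] [Field L] [Algebra F L] (x : L) :
    x ∈ Set.range (algebraMap F L) ↔ x ^ Fintype.card F - x = 0 := by
  constructor
  · rintro ⟨a, rfl⟩
    rw [← map_pow, FiniteField.pow_card, sub_self]
  · intro hx
    have hs : (X ^ Fintype.card F - X : F[X]).Splits := by
      rw [splits_iff_card_roots, FiniteField.roots_X_pow_card_sub_X,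
        FiniteField.X_pow_card_sub_X_natDegree_eq F Fintype.one_lt_card]
      rfl
    have h := hs.roots_map (algebraMap F L)
    have hmem : x ∈ ((X ^ Fintype.card F - X : F[X]).map (algebraMap F L)).roots := by
      rw [mem_roots]
      · simpa [IsRoot] using hx
      · rw [Polynomial.map_ne_zero_iff (algebraMap F L).injective]
        exact FiniteField.X_pow_card_sub_X_ne_zero F Fintype.one_lt_card
    rw [h, Multiset.mem_map] at hmem
    obtain ⟨a, -, ha⟩ := hmem
    exact ⟨a, ha⟩

/-- For nonzero `λ ^ q - λ`, the roots of this polynomial are the solutions of `j(λ) = c`. -/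
noncomputable def jFiberPoly {L : Type*} [Field L] (q : ℕ) (t c : L) : L[X] :=
  C (t ^ q) * (1 + (X ^ q - X) ^ (q - 1)) ^ (q + 1) - C c * (X ^ q - X) ^ (q ^ 2 - q)

section jFiberPoly

variable {L : Type*} [Field L] {q : ℕ} {t c : L}

theorem eval_jFiberPoly (x : L) :
    (jFiberPoly q t c).eval x =
      t ^ q * (1 + (x ^ q - x) ^ (q - 1)) ^ (q + 1) - c * (x ^ q - x) ^ (q ^ 2 - q) := by
  simp [jFiberPoly]

theorem natDegree_jFiberPoly (hq : 1 < q) (ht : t ≠ 0) :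
    (jFiberPoly q t c).natDegree = q ^ 3 - q := by
  have hU : (X ^ q - X : L[X]).natDegree = q := FiniteField.X_pow_card_sub_X_natDegree_eq L hq
  have hV : (1 + (X ^ q - X) ^ (q - 1) : L[X]).natDegree = (q - 1) * q := by
    rw [add_comm, natDegree_add_eq_left_of_natDegree_lt] <;> rw [natDegree_pow, hU]
    rw [natDegree_one]
    exact Nat.mul_pos (by omega) (by omega)
  have hA : (C (t ^ q) * (1 + (X ^ q - X) ^ (q - 1)) ^ (q + 1) : L[X]).natDegree =
      (q + 1) * ((q - 1) * q) := by
    rw [natDegree_C_mul (pow_ne_zero q ht), natDegree_pow, hV]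
  have hB : (C c * (X ^ q - X) ^ (q ^ 2 - q) : L[X]).natDegree ≤ (q ^ 2 - q) * q := by
    refine (natDegree_C_mul_le _ _).trans ?_
    rw [natDegree_pow, hU]
  obtain ⟨m, rfl⟩ := Nat.exists_eq_add_of_lt hq
  have h2 : (1 + m + 1) ^ 2 - (1 + m + 1) = (m + 2) * (m + 1) :=
    Nat.sub_eq_of_eq_add (by ring)
  have h3 : (1 + m + 1) ^ 3 - (1 + m + 1) = (m + 3) * (m + 2) * (m + 1) :=
    Nat.sub_eq_of_eq_add (by ring)
  have h1 : 1 + m + 1 - 1 = m + 1 := by omega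
  rw [jFiberPoly, natDegree_sub_eq_left_of_natDegree_lt, hA, h1, h3]
  · ring
  · refine hB.trans_lt ?_
    rw [hA, h1, h2]
    nlinarith [Nat.zero_le m]

theorem pow_card_sub_ne_zero_of_eval_jFiberPoly_eq_zero (hq : 1 < q) (ht : t ≠ 0) {x : L}
    (hx : (jFiberPoly q t c).eval x = 0) : x ^ q - x ≠ 0 := by
  intro hu
  have h2 : q ^ 2 - q ≠ 0 := by
    have : q < q ^ 2 := by nlinarith
    omega
  rw [eval_jFiberPoly, hu, zero_pow h2, zero_pow (by omega)] at hx
  simp [ht] at hx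

theorem eval_jFiberPoly_eq_zero_iff {x : L} (hx : x ^ q - x ≠ 0) :
    (jFiberPoly q t c).eval x = 0 ↔
      t ^ q * (1 + (x ^ q - x) ^ (q - 1)) ^ (q + 1) / (x ^ q - x) ^ (q ^ 2 - q) = c := by
  rw [eval_jFiberPoly, sub_eq_zero, div_eq_iff (pow_ne_zero _ hx)]

theorem derivative_jFiberPoly (hq : 1 < q) (hq0 : (q : L) = 0) :
    derivative (jFiberPoly q t c) =
      C (t ^ q) * (1 + (X ^ q - X) ^ (q - 1)) ^ q * (X ^ q - X) ^ (q - 2) := by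
  have h2 : ((q ^ 2 - q : ℕ) : L) = 0 := by
    rw [Nat.cast_sub (by nlinarith), Nat.cast_pow, hq0]
    simp
  have h1 : ((q - 1 : ℕ) : L) = -1 := by
    rw [Nat.cast_sub hq.le, hq0]
    simp
  rw [jFiberPoly]
  simp only [derivative_sub, derivative_mul, derivative_C, derivative_pow, derivative_add,
    derivative_X, derivative_one, h1, h2, hq0, Nat.cast_add, Nat.cast_one, Nat.add_sub_cancel]
  rw [show q - 1 - 1 = q - 2 by omega]
  simp
  ring

theorem separable_jFiberPoly [IsAlgClosed L] (hq : 1 < q) (hq0 : (q : L) = 0) (ht : t ≠ 0)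
    (hc : c ≠ 0) : (jFiberPoly q t c).Separable := by
  rw [Polynomial.Separable, isCoprime_iff_aeval_ne_zero_of_isAlgClosed L L]
  intro x
  by_contra! h
  obtain ⟨h0, h1⟩ := h
  rw [coe_aeval_eq_eval] at h0 h1
  have hu := pow_card_sub_ne_zero_of_eval_jFiberPoly_eq_zero hq ht h0
  rw [derivative_jFiberPoly hq hq0] at h1
  have hv : 1 + (x ^ q - x) ^ (q - 1) = 0 := by
    simp only [eval_mul, eval_C, eval_pow, eval_add, eval_one, eval_sub, eval_X, mul_eq_zero,
      pow_ne_zero _ ht, pow_ne_zero _ hu, false_or, or_false] at h1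
    exact eq_zero_of_pow_eq_zero h1
  rw [eval_jFiberPoly, hv, zero_pow (by omega), mul_zero, zero_sub, neg_eq_zero] at h0
  exact mul_ne_zero hc (pow_ne_zero _ hu) h0

end jFiberPoly

/-- Let `L` be an algebraically closed field containing `𝔽_q` and `t ∈ L`, `t ≠ 0`. The map
`λ ↦ j(λ) = t^q (1 + (λ^q - λ)^{q-1})^{q+1} / (λ^q - λ)^{q^2 - q}` from `L ∖ 𝔽_q` to `L` is
surjective, and for every `c ≠ 0` the fiber above `c` has exactly `q^3 - q` elements. -/
theorem j_surjective_and_fibers (q : ℕ) (F : Type*) [Field F] [Fintype F]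
    (hF : Fintype.card F = q) (L : Type*) [Field L] [IsAlgClosed L] [Algebra F L]
    (t : L) (ht : t ≠ 0) :
    (∀ c : L, ∃ lam : L, lam ∉ Set.range (algebraMap F L) ∧
        t ^ q * (1 + (lam ^ q - lam) ^ (q - 1)) ^ (q + 1) / (lam ^ q - lam) ^ (q ^ 2 - q)
          = c) ∧
      ∀ c : L, c ≠ 0 →
        {lam : L | lam ∉ Set.range (algebraMap F L) ∧
            t ^ q * (1 + (lam ^ q - lam) ^ (q - 1)) ^ (q + 1) / (lam ^ q - lam) ^ (q ^ 2 - q)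
              = c}.ncard = q ^ 3 - q := by
  subst hF
  have hq : 1 < Fintype.card F := Fintype.one_lt_card
  have hq0 : (Fintype.card F : L) = 0 := by
    rw [← map_natCast (algebraMap F L), FiniteField.cast_card_eq_zero, map_zero]
  have hfiber (c x : L) : (jFiberPoly (Fintype.card F) t c).eval x = 0 ↔
      x ∉ Set.range (algebraMap F L) ∧
        t ^ Fintype.card F * (1 + (x ^ Fintype.card F - x) ^ (Fintype.card F - 1)) ^
          (Fintype.card F + 1) / (x ^ Fintype.card F - x) ^
            (Fintype.card F ^ 2 - Fintype.card F) = c := by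
    rw [FiniteField.mem_range_algebraMap_iff_pow_card_sub_eq_zero]
    constructor
    · intro h
      have hu := pow_card_sub_ne_zero_of_eval_jFiberPoly_eq_zero hq ht h
      exact ⟨hu, (eval_jFiberPoly_eq_zero_iff hu).1 h⟩
    · rintro ⟨hu, h⟩
      exact (eval_jFiberPoly_eq_zero_iff hu).2 h
  have hpos : 0 < Fintype.card F ^ 3 - Fintype.card F :=
    Nat.sub_pos_of_lt (lt_self_pow₀ hq (by norm_num))
  have hdeg (c : L) := natDegree_jFiberPoly (c := c) hq ht
  refine ⟨fun c => ?_, fun c hc => ?_⟩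
  · obtain ⟨x, hx⟩ := IsAlgClosed.exists_root (jFiberPoly (Fintype.card F) t c)
      (natDegree_pos_iff_degree_pos.1 ((hdeg c).symm ▸ hpos)).ne'
    exact ⟨x, (hfiber c x).1 hx⟩
  · have hne : jFiberPoly (Fintype.card F) t c ≠ 0 := by
      intro h
      have := hdeg c
      rw [h, natDegree_zero] at this
      omega
    rw [← hdeg c, ← card_rootSet_eq_natDegree (K := L) (separable_jFiberPoly hq hq0 ht hc)
      (IsAlgClosed.splits _), ← Set.toFinset_card, ← Set.ncard_eq_toFinset_card']
    congr 1
    ext x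
    rw [mem_rootSet_of_ne hne, coe_aeval_eq_eval, hfiber, Set.mem_ofPred_eq]
end
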